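/- arXiv:1806.00689 — 4 statements merged into one kernel-verified Lean document; each statement's English description precedes it below -/
import Mathlib

section
/- Let I be a finite set of positive integers with m = max(I ∪ {0}), and let d(I,·) denote its descent polynomial. Then for every positive integer n, (−1)^m · d(I,−n) ≥ 0; moreover, for every integer n > 1, (−1)^m · d(I,−n) > 0. -/
/-- The descent set of a permutation of `{1,…,n}` (modeled on `Fin n`), as a set of
1-indexed positions `i ∈ {1, …, n-1}` with `π_i > π_{i+1}`. -/
noncomputable def descSet (n : ℕ) (π : Equiv.Perm (Fin n)) : Finset ℕ :=
  @Finset.filter _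
    (fun i => ∃ (h1 : i - 1 < n) (h2 : i < n), π ⟨i, h2⟩ < π ⟨i - 1, h1⟩)
    (Classical.decPred _) (Finset.Ioo 0 n)

/-- `dCount I n` is the number of permutations of `{1,…,n}` with descent set `I`. -/
noncomputable def dCount (I : Finset ℕ) (n : ℕ) : ℕ :=
  Nat.card {π : Equiv.Perm (Fin n) // descSet n π = I}

/-- `mI I = max (I ∪ {0})`. -/
def mI (I : Finset ℕ) : ℕ := I.sup id

/-- Signed recursion for the descent polynomial of a strictly decreasing list. -/
noncomputable def FF : List ℕ → ℤ → ℤ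
  | [], _ => 1
  | m :: L, x => Ring.choose x m * FF L m - FF L x

def SS : List ℕ → List (List ℕ)
  | [] => []
  | m :: L => (SS L).map (List.cons (m-1)) ++ (if m - 1 ∈ L then [] else [(m-1)::L, L])

theorem SS_valid (L : List ℕ) (hL : L.Pairwise (· > ·)) (h0 : 0 ∉ L) :
    ∀ K ∈ SS L, K.Pairwise (· > ·) ∧ ∀ x ∈ K, ∃ l ∈ L, x < l := by
  induction L with
  | nil => simp [SS]
  | cons m L ih =>
    rw [List.pairwise_cons] at hL
    simp only [List.mem_cons, not_or] at h0
    obtain ⟨hm, hL⟩ := hL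
    have ih := ih hL h0.2
    intro K hK
    simp only [SS, List.mem_append, List.mem_map] at hK
    rcases hK with ⟨K', hK', rfl⟩ | hK
    · obtain ⟨h1, h2⟩ := ih K' hK'
      refine ⟨?_, ?_⟩
      · rw [List.pairwise_cons]
        refine ⟨fun a ha => ?_, h1⟩
        obtain ⟨l, hl, hal⟩ := h2 a ha
        have := hm l hl
        omega
      · intro x hx
        rw [List.mem_cons] at hx
        refine ⟨m, by simp, ?_⟩
        rcases hx with rfl | hx
        · omega
        · obtain ⟨l, hl, hal⟩ := h2 x hx
          have := hm l hl
          omega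
    · split_ifs at hK with hh
      · simp at hK
      · simp only [List.mem_cons, List.not_mem_nil, or_false] at hK
        rcases hK with rfl | rfl
        · refine ⟨?_, ?_⟩
          · rw [List.pairwise_cons]
            refine ⟨fun a ha => ?_, hL⟩
            have := hm a ha
            have : a ≠ m - 1 := fun h => hh (h ▸ ha)
            omega
          · intro x hx
            refine ⟨m, by simp, ?_⟩
            rw [List.mem_cons] at hx
            rcases hx with rfl | hx
            · omega
            · exact hm x hx
        · exact ⟨hL, fun x hx => ⟨m, by simp, hm x hx⟩⟩

theorem FF_head (m : ℕ) (L : List ℕ) : FF (m :: L) m = 0 := by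
  simp [FF, Ring.choose_natCast]

theorem FF_zero (L : List ℕ) (hL : L.Pairwise (· > ·)) (h0 : 0 ∈ L) (x : ℤ) : FF L x = 0 := by
  induction L generalizing x with
  | nil => simp at h0
  | cons m L ih =>
    rw [List.pairwise_cons] at hL
    by_cases h : 0 ∈ L
    · simp [FF, ih hL.2 h]
    · have : m = 0 := by simp at h0; rcases h0 with h0 | h0; exact h0.symm; exact absurd h0 h
      subst this
      cases L with
      | nil => simp [FF]
      | cons a L => have := hL.1 a (by simp); omega

theorem SS_sum (m : ℕ) (L : List ℕ) (x : ℤ) : ((SS (m::L)).map (FF · x)).sum =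
    ((SS L).map (fun K => FF ((m-1)::K) x)).sum +
    (if m - 1 ∈ L then 0 else Ring.choose x (m-1) * FF L ((m-1 : ℕ):ℤ)) := by
  simp only [SS, List.map_append, List.sum_append, List.map_map]
  congr 1
  split_ifs
  · simp
  · simp [FF]

theorem sum_aux (l : List (List ℕ)) (c x y : ℤ) :
    (l.map (fun K => c * FF K y - FF K x)).sum
      = c * (l.map (FF · y)).sum - (l.map (FF · x)).sum := by
  induction l with
  | nil => simp
  | cons a l ih => simp only [List.map_cons, List.sum_cons, ih]; ring

theorem FF_pred (m : ℕ) (L : List ℕ) (hL : (m :: L).Pairwise (· > ·)) (hm : 0 < m)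
    (h : m - 1 ∈ L) : ∃ L', L = (m-1) :: L' := by
  rw [List.pairwise_cons] at hL
  cases L with
  | nil => simp at h
  | cons a L =>
    refine ⟨L, ?_⟩
    have h1 := hL.1 a (by simp)
    have h2 := hL.2
    rw [List.pairwise_cons] at h2
    simp only [List.mem_cons] at h
    rcases h with h | h
    · rw [h]
    · have := h2.1 _ h
      omega

theorem FF_delta (L : List ℕ) (hL : L.Pairwise (· > ·)) (h0 : 0 ∉ L) (x : ℤ) :
    FF L (x+1) - FF L x = ((SS L).map (FF · x)).sum := by
  induction L generalizing x with
  | nil => simp [SS, FF]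
  | cons m L ih =>
    rw [SS_sum]
    have hL' := hL
    rw [List.pairwise_cons] at hL
    simp only [List.mem_cons, not_or] at h0
    have ih := ih hL.2 h0.2
    obtain ⟨k, rfl⟩ : ∃ k, m = k + 1 := ⟨m - 1, by omega⟩
    simp only [Nat.add_sub_cancel, FF, sum_aux]
    rw [← ih, ← ih, Ring.choose_succ_succ]
    push_cast
    split_ifs with h
    · obtain ⟨L', rfl⟩ := FF_pred _ _ hL' (by omega) h
      simp only [Nat.add_sub_cancel, FF_head]
      ring
    · ring

theorem SS_exists (L : List ℕ) (h0 : 0 ∉ L) (hne : L ≠ []) : ∃ K ∈ SS L, 0 ∉ K := by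
  induction L with
  | nil => simp at hne
  | cons m L ih =>
    simp only [List.mem_cons, not_or] at h0
    by_cases h : m - 1 ∈ L
    · obtain ⟨K, hK, hK0⟩ := ih h0.2 (by rintro rfl; simp at h)
      refine ⟨(m-1)::K, by simp [SS, hK], ?_⟩
      simp only [List.mem_cons, not_or]
      refine ⟨fun h' => ?_, hK0⟩
      rw [← h'] at h
      exact h0.2 h
    · exact ⟨L, by simp [SS, h], h0.2⟩

theorem FF_pos (N : ℕ) : ∀ L : List ℕ, L.Pairwise (· > ·) → (∀ x ∈ L, x < N) →
    0 ≤ FF L N ∧ (0 ∉ L → 0 < FF L N) := by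
  induction N using Nat.strong_induction_on with
  | _ N ih =>
  intro L hL hN
  by_cases h0 : 0 ∈ L
  · simp [FF_zero L hL h0, h0]
  suffices 0 < FF L N from ⟨this.le, fun _ => this⟩
  cases L with
  | nil => simp [FF]
  | cons m L =>
    have hmN := hN m (by simp)
    obtain ⟨M, rfl⟩ : ∃ M, N = M + 1 := ⟨N - 1, by omega⟩
    have hd := FF_delta _ hL h0 M
    rw [SS_sum] at hd
    have hpw := hL
    rw [List.pairwise_cons] at hL
    have h0' := h0
    simp only [List.mem_cons, not_or] at h0
    have hK : ∀ K ∈ SS L, ((m-1)::K).Pairwise (· > ·) ∧ ∀ x ∈ (m-1)::K, x < M := by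
      intro K hK
      obtain ⟨h1, h2⟩ := SS_valid _ hpw h0' ((m-1)::K) (by simp [SS, hK])
      refine ⟨h1, fun x hx => ?_⟩
      have : x ≤ m - 1 := by
        rw [List.pairwise_cons] at h1
        rw [List.mem_cons] at hx
        rcases hx with rfl | hx
        · exact le_rfl
        · exact (h1.1 x hx).le
      omega
    have hsum : 0 ≤ ((SS L).map (fun K => FF ((m-1)::K) M)).sum := by
      apply List.sum_nonneg
      intro y hy
      simp only [List.mem_map] at hy
      obtain ⟨K, hK', rfl⟩ := hy
      exact (ih M (by omega) _ (hK K hK').1 (hK K hK').2).1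
    have hbase : 0 ≤ FF (m::L) M := by
      rcases Nat.lt_or_ge m M with h | h
      · refine (ih M (by omega) _ hpw ?_).1
        intro x hx
        rw [List.mem_cons] at hx
        rcases hx with rfl | hx
        · exact h
        · have := hL.1 x hx; omega
      · have : M = m := by omega
        subst this
        rw [FF_head]
    push_cast
    by_cases h : m - 1 ∈ L
    · rw [if_pos h] at hd
      have : 0 < ((SS L).map (fun K => FF ((m-1)::K) M)).sum := by
        obtain ⟨K, hK', hK0⟩ := SS_exists L h0.2 (by rintro rfl; simp at h)
        have hle := List.single_le_sum (l := (SS L).map (fun K => FF ((m-1)::K) M)) (by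
          intro y hy
          simp only [List.mem_map] at hy
          obtain ⟨K, hK', rfl⟩ := hy
          exact (ih M (by omega) _ (hK K hK').1 (hK K hK').2).1) _ (List.mem_map_of_mem hK')
        refine lt_of_lt_of_le ?_ hle
        refine (ih M (by omega) _ (hK K hK').1 (hK K hK').2).2 ?_
        simp only [List.mem_cons, not_or]
        exact ⟨fun h' => h0.2 (by rw [h']; exact h), hK0⟩
      linarith
    · rw [if_neg h] at hd
      have h1 : 0 < FF L ((m-1:ℕ):ℤ) := by
        refine (ih (m-1) (by omega) L hL.2 ?_).2 h0.2
        intro x hx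
        have := hL.1 x hx
        have : x ≠ m - 1 := fun h' => h (h' ▸ hx)
        omega
      have h2 : 0 < Ring.choose (M:ℤ) (m-1) := by
        rw [Ring.choose_natCast]
        exact_mod_cast Nat.choose_pos (by omega)
      have := mul_pos h2 h1
      linarith

theorem choose_neg_pos (n m : ℕ) (hn : 0 < n) : 0 < (-1 : ℤ)^m * Ring.choose (-(n:ℤ)) m := by
  rw [Ring.choose_neg]
  obtain ⟨k, rfl⟩ : ∃ k, n = k + 1 := ⟨n - 1, by omega⟩
  have : ((k+1:ℕ):ℤ) + m - 1 = ((k + m : ℕ) : ℤ) := by push_cast; ring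
  rw [this, Ring.choose_natCast]
  have h2 : 0 < (k+m).choose m := Nat.choose_pos (by omega)
  have h3 : (-1:ℤ)^m * (-1)^m = 1 := by rw [← mul_pow]; simp
  simp only [Int.negOnePow_def, Units.smul_def]
  simp
  rw [← mul_assoc, h3]
  simpa using h2

theorem FF_at_zero (L : List ℕ) (h0 : 0 ∉ L) : |FF L 0| = 1 := by
  induction L with
  | nil => simp [FF]
  | cons m L ih =>
    simp only [List.mem_cons, not_or] at h0
    have : Ring.choose (0:ℤ) m = 0 := by
      have := Ring.choose_natCast (R := ℤ) 0 m
      rw [Nat.choose_eq_zero_of_lt (by omega)] at this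
      simpa using this
    simp [FF, this, ih h0.2]

theorem FF_neg (m : ℕ) : ∀ L : List ℕ, (m :: L).Pairwise (· > ·) → ∀ n : ℕ, 0 < n →
    0 ≤ (-1)^m * FF (m::L) (-n) ∧ (0 ∉ m :: L → 1 < n → 0 < (-1)^m * FF (m::L) (-n)) := by
  induction m using Nat.strong_induction_on with
  | _ m ih =>
  intro L hpw n hn
  by_cases h0 : 0 ∈ m :: L
  · rw [FF_zero _ hpw h0]
    exact ⟨by simp, fun h => absurd h0 h⟩
  have h0' := h0
  have hL := hpw
  rw [List.pairwise_cons] at hL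
  simp only [List.mem_cons, not_or] at h0
  obtain ⟨k, rfl⟩ : ∃ k, m = k + 1 := ⟨m - 1, by omega⟩
  by_cases h : k ∈ L
  · suffices 0 < (-1)^(k+1) * FF ((k+1)::L) (-n) from ⟨this.le, fun _ _ => this⟩
    obtain ⟨L', rfl⟩ := FF_pred _ _ hpw (by omega) h
    simp only [Nat.add_sub_cancel] at *
    have h1 := (ih k (by omega) L' hL.2 n hn).1
    have h2 := choose_neg_pos n (k+1) hn
    have h3 := (FF_pos (k+1) _ hL.2 hL.1).2 h0.2
    have h4 := mul_pos h2 h3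
    rw [FF]
    rw [pow_succ] at *
    linarith
  · have key : ∀ n : ℕ, (n:ℤ) - 1 ≤ (-1)^(k+1) * FF ((k+1)::L) (-n) := by
      intro n
      induction n with
      | zero =>
        have := FF_at_zero _ h0'
        have h5 : |(-1:ℤ)^(k+1) * FF ((k+1)::L) 0| = 1 := by
          rw [abs_mul, this]; simp
        have := neg_abs_le ((-1:ℤ)^(k+1) * FF ((k+1)::L) 0)
        rw [h5] at this
        simpa using this
      | succ n ihn =>
        have hd := FF_delta _ hpw h0' (-((n+1:ℕ):ℤ))
        rw [SS_sum, show -((n+1:ℕ):ℤ) + 1 = -n by push_cast; ring] at hd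
        simp only [Nat.add_sub_cancel] at hd
        rw [if_neg h] at hd
        have hs : 0 ≤ (-1)^k * ((SS L).map (fun K => FF (k::K) (-((n+1:ℕ):ℤ)))).sum := by
          rw [← List.sum_map_mul_left]
          apply List.sum_nonneg
          intro y hy
          simp only [List.mem_map] at hy
          obtain ⟨K, hK, rfl⟩ := hy
          have h1 := (SS_valid _ hpw h0' (k::K) (by simp [SS, hK])).1
          exact (ih k (by omega) K h1 (n+1) (by omega)).1
        have h3 : 0 < FF L (k:ℤ) := by
          refine (FF_pos k L hL.2 ?_).2 h0.2
          intro x hx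
          have := hL.1 x hx
          have : x ≠ k := fun h' => h (h' ▸ hx)
          omega
        have h4 := mul_pos (choose_neg_pos (n+1) k (by omega)) h3
        have h5 := congrArg (fun z => (-1:ℤ)^k * z) hd
        rw [pow_succ] at *
        push_cast at *
        have h6 : (1:ℤ) ≤ _ := h4
        linarith
    have := key n
    refine ⟨by omega, fun _ hn1 => by omega⟩

theorem FF_poly (L : List ℕ) : ∃ Q : Polynomial ℚ, ∀ x : ℤ, Q.eval (x:ℚ) = FF L x := by
  induction L with
  | nil => exact ⟨1, by simp [FF]⟩
  | cons m L ih =>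
    obtain ⟨Q, hQ⟩ := ih
    refine ⟨Polynomial.C ((FF L m : ℚ) / m.factorial) * descPochhammer ℚ m - Q, fun x => ?_⟩
    have h := Ring.descPochhammer_eq_factorial_smul_choose x m
    have h2 : (descPochhammer ℚ m).eval (x:ℚ) = m.factorial * (Ring.choose x m : ℤ) := by
      have h3 : (descPochhammer ℤ m).eval x = m.factorial * (Ring.choose x m : ℤ) := by
        rw [← Polynomial.eval_eq_smeval] at h
        rw [h]; simp
      rw [← descPochhammer_map (Int.castRingHom ℚ) m]
      have := Polynomial.eval_intCast_map (Int.castRingHom ℚ) (descPochhammer ℤ m) x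
      simp only [eq_intCast] at this
      rw [Int.cast_id] at this
      rw [this, h3]; simp
    simp only [Polynomial.eval_sub, Polynomial.eval_mul, Polynomial.eval_C, hQ, h2, FF]
    have : (m.factorial : ℚ) ≠ 0 := by positivity
    push_cast
    field_simp

theorem mem_descSet (n : ℕ) (π : Equiv.Perm (Fin n)) (i : ℕ) :
    i + 1 ∈ descSet n π ↔ ∃ (h2 : i + 1 < n), π ⟨i+1, h2⟩ < π ⟨i, by omega⟩ := by
  classical
  unfold descSet
  rw [@Finset.mem_filter _ _ (Classical.decPred _), Finset.mem_Ioo]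
  constructor
  · rintro ⟨_, _, h2, h⟩
    exact ⟨h2, h⟩
  · rintro ⟨h2, h⟩
    exact ⟨⟨by omega, h2⟩, by simp; omega, h2, h⟩

theorem zero_notMem_descSet (n : ℕ) (π : Equiv.Perm (Fin n)) : 0 ∉ descSet n π := by
  classical
  unfold descSet
  rw [@Finset.mem_filter _ _ (Classical.decPred _), Finset.mem_Ioo]
  simp

theorem lt_of_mem_descSet (n : ℕ) (π : Equiv.Perm (Fin n)) (i : ℕ) (h : i ∈ descSet n π) :
    i < n := by
  classical
  unfold descSet at h
  rw [@Finset.mem_filter _ _ (Classical.decPred _), Finset.mem_Ioo] at h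
  exact h.1.2

/-- Glue a subset and a permutation. -/
noncomputable def glue (m k : ℕ) (S : Finset (Fin (m+k))) (h : S.card = m) (h' : Sᶜ.card = k)
    (σ : Equiv.Perm (Fin m)) : Equiv.Perm (Fin (m+k)) :=
  finSumFinEquiv.symm.trans ((Equiv.sumCongr σ (Equiv.refl _)).trans (finSumEquivOfFinset h h'))

theorem glue_left (m k : ℕ) (S : Finset (Fin (m+k))) (h : S.card = m) (h' : Sᶜ.card = k)
    (σ : Equiv.Perm (Fin m)) (i : Fin m) :
    glue m k S h h' σ (Fin.castAdd k i) = S.orderEmbOfFin h (σ i) := by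
  simp [glue]

theorem glue_right (m k : ℕ) (S : Finset (Fin (m+k))) (h : S.card = m) (h' : Sᶜ.card = k)
    (σ : Equiv.Perm (Fin m)) (i : Fin k) :
    glue m k S h h' σ (Fin.natAdd m i) = Sᶜ.orderEmbOfFin h' i := by
  simp [glue]

theorem glue_desc (m k : ℕ) (S : Finset (Fin (m+k))) (h : S.card = m) (h' : Sᶜ.card = k)
    (σ : Equiv.Perm (Fin m)) :
    (descSet (m+k) (glue m k S h h' σ)).erase m = descSet m σ := by
  ext i
  cases i with
  | zero => simp [zero_notMem_descSet]
  | succ i =>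
    rw [Finset.mem_erase, mem_descSet, mem_descSet]
    constructor
    · rintro ⟨hne, h2, hlt⟩
      rcases Nat.lt_or_ge (i+1) m with hi | hi
      · refine ⟨hi, ?_⟩
        have e1 := glue_left m k S h h' σ ⟨i+1, hi⟩
        have e2 := glue_left m k S h h' σ ⟨i, by omega⟩
        simp only [Fin.castAdd_mk] at e1 e2
        rw [e1, e2] at hlt
        simpa using hlt
      · exfalso
        have e1 := glue_right m k S h h' σ ⟨i+1-m, by omega⟩
        have e2 := glue_right m k S h h' σ ⟨i-m, by omega⟩
        simp only [Fin.natAdd_mk] at e1 e2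
        have q1 : m + (i+1-m) = i+1 := by omega
        have q2 : m + (i-m) = i := by omega
        simp only [q1, q2] at e1 e2
        rw [e1, e2] at hlt
        simp at hlt
        omega
    · rintro ⟨hi, hlt⟩
      refine ⟨by omega, by omega, ?_⟩
      have e1 := glue_left m k S h h' σ ⟨i+1, hi⟩
      have e2 := glue_left m k S h h' σ ⟨i, by omega⟩
      simp only [Fin.castAdd_mk] at e1 e2
      rw [e1, e2]
      simpa using hlt

theorem glue_image (m k : ℕ) (S : Finset (Fin (m+k))) (h : S.card = m) (h' : Sᶜ.card = k)
    (σ : Equiv.Perm (Fin m)) :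
    Finset.univ.image (fun i : Fin m => glue m k S h h' σ (Fin.castAdd k i)) = S := by
  ext x
  simp only [glue_left, Finset.mem_image, Finset.mem_univ, true_and]
  constructor
  · rintro ⟨i, rfl⟩
    simp
  · intro hx
    have : x ∈ Set.range (S.orderEmbOfFin h) := by rw [Finset.range_orderEmbOfFin]; exact hx
    obtain ⟨j, rfl⟩ := this
    exact ⟨σ.symm j, by simp⟩

theorem glue_inj (m k : ℕ) (S T : Finset (Fin (m+k))) (h : S.card = m) (h' : Sᶜ.card = k)
    (g : T.card = m) (g' : Tᶜ.card = k)
    (σ τ : Equiv.Perm (Fin m)) (he : glue m k S h h' σ = glue m k T g g' τ) :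
    S = T ∧ σ = τ := by
  have hST : S = T := by
    rw [← glue_image m k S h h' σ, ← glue_image m k T g g' τ, he]
  subst hST
  refine ⟨rfl, ?_⟩
  ext i
  have := congrArg (fun f : Equiv.Perm (Fin (m+k)) => f (Fin.castAdd k i)) he
  simp only [glue_left] at this
  rw [(S.orderEmbOfFin h).injective this]

theorem glue_surj (m k : ℕ) (π : Equiv.Perm (Fin (m+k)))
    (hπ : ∀ i ∈ (descSet (m+k) π).erase m, i < m) :
    ∃ (S : Finset (Fin (m+k))) (h : S.card = m) (h' : Sᶜ.card = k) (σ : Equiv.Perm (Fin m)),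
      glue m k S h h' σ = π := by
  let S : Finset (Fin (m+k)) := Finset.univ.image (fun i : Fin m => π (Fin.castAdd k i))
  have hinj : Function.Injective (fun i : Fin m => π (Fin.castAdd k i)) :=
    π.injective.comp (Fin.castAdd_injective m k)
  have h : S.card = m := by
    rw [Finset.card_image_of_injective _ hinj]; simp
  have h' : Sᶜ.card = k := by
    rw [Finset.card_compl, h]; simp
  have hmem : ∀ i : Fin m, π (Fin.castAdd k i) ∈ S := fun i =>
    Finset.mem_image_of_mem _ (Finset.mem_univ i)
  let f : Fin m → Fin m := fun i => (S.orderIsoOfFin h).symm ⟨π (Fin.castAdd k i), hmem i⟩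
  have hf : Function.Injective f := by
    intro i j hij
    have := (S.orderIsoOfFin h).symm.injective hij
    exact hinj (Subtype.ext_iff.mp this)
  have hfb : Function.Bijective f := Finite.injective_iff_bijective.mp hf
  refine ⟨S, h, h', Equiv.ofBijective f hfb, ?_⟩
  have htail : (fun i : Fin k => π (Fin.natAdd m i)) = Sᶜ.orderEmbOfFin h' := by
    apply Finset.orderEmbOfFin_unique
    · intro x
      rw [Finset.mem_compl]
      intro hx
      obtain ⟨i, _, hi⟩ := Finset.mem_image.mp hx
      have := congrArg Fin.val (π.injective hi)
      simp at this
      omega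
    · cases k with
      | zero => intro a; exact a.elim0
      | succ k =>
        rw [Fin.strictMono_iff_lt_succ]
        intro i
        by_contra hcon
        have hne : π (Fin.natAdd m i.castSucc) ≠ π (Fin.natAdd m i.succ) := by
          intro hh
          have := congrArg Fin.val (π.injective hh)
          simp at this
        have hlt : π (Fin.natAdd m i.succ) < π (Fin.natAdd m i.castSucc) :=
          lt_of_le_of_ne (not_lt.mp hcon) hne.symm
        have hd : m + i.val + 1 ∈ descSet (m+(k+1)) π := by
          rw [mem_descSet]
          exact ⟨by omega, hlt⟩
        have := hπ _ (Finset.mem_erase.mpr ⟨by omega, hd⟩)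
        omega
  ext1 x
  induction x using Fin.addCases with
  | left i =>
    rw [glue_left]
    simp only [Equiv.ofBijective_apply, f]
    rw [← Finset.coe_orderIsoOfFin_apply]
    simp
  | right i =>
    rw [glue_right, ← htail]

theorem card_glue (m k : ℕ) (J : Finset ℕ) (hJ : ∀ i ∈ J, i < m) :
    Nat.card {π : Equiv.Perm (Fin (m+k)) // (descSet (m+k) π).erase m = J}
      = (m+k).choose m * dCount J m := by
  have hc : ∀ S : Finset (Fin (m+k)), S.card = m → Sᶜ.card = k := by
    intro S h
    rw [Finset.card_compl, h]; simp
  let Φ : {S : Finset (Fin (m+k)) // S.card = m} × {σ : Equiv.Perm (Fin m) // descSet m σ = J} →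
      {π : Equiv.Perm (Fin (m+k)) // (descSet (m+k) π).erase m = J} := fun q =>
    ⟨glue m k q.1.1 q.1.2 (hc _ q.1.2) q.2.1, by rw [glue_desc]; exact q.2.2⟩
  have hΦ : Function.Bijective Φ := by
    constructor
    · rintro ⟨⟨S, h⟩, ⟨σ, hσ⟩⟩ ⟨⟨T, g⟩, ⟨τ, hτ⟩⟩ he
      have := glue_inj _ _ _ _ _ _ _ _ _ _ (Subtype.ext_iff.mp he)
      obtain ⟨h1, h2⟩ := this
      simp only at h1 h2
      subst h1; subst h2; rfl
    · rintro ⟨π, hπ⟩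
      obtain ⟨S, h, h', σ, he⟩ := glue_surj m k π (by rw [hπ]; exact hJ)
      refine ⟨⟨⟨S, h⟩, ⟨σ, ?_⟩⟩, ?_⟩
      · rw [← glue_desc m k S h h', he, hπ]
      · exact Subtype.ext he
  rw [← Nat.card_eq_of_bijective Φ hΦ, Nat.card_prod]
  congr 1
  simp [Nat.card_eq_fintype_card]

theorem dCount_rec (m N : ℕ) (hN : m < N) (J : Finset ℕ) (hJ : ∀ i ∈ J, i < m) :
    dCount (insert m J) N + dCount J N = N.choose m * dCount J m := by
  obtain ⟨k, rfl⟩ : ∃ k, N = m + k := ⟨N - m, by omega⟩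
  rw [← card_glue m k J hJ]
  have hm : m ∉ J := fun h => lt_irrefl _ (hJ m h)
  classical
  unfold dCount
  simp only [Nat.card_eq_fintype_card, Fintype.card_subtype]
  rw [← Finset.card_union_of_disjoint]
  · congr 1
    ext π
    simp only [Finset.mem_union, Finset.mem_filter, Finset.mem_univ, true_and]
    constructor
    · rintro (h | h)
      · rw [h, Finset.erase_insert hm]
      · rw [h, Finset.erase_eq_of_notMem hm]
    · intro h
      by_cases hd : m ∈ descSet (m+k) π
      · left; rw [← h, Finset.insert_erase hd]
      · right; rw [← h, Finset.erase_eq_of_notMem hd]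
  · rw [Finset.disjoint_filter]
    intro π _ h1 h2
    apply hm
    rw [← h2, h1]
    simp

theorem dCount_empty (N : ℕ) : dCount ∅ N = 1 := by
  unfold dCount
  rw [Nat.card_eq_one_iff_unique]
  have key : ∀ π : Equiv.Perm (Fin N), descSet N π = ∅ ↔ π = 1 := by
    intro π
    constructor
    · intro h
      have hm : StrictMono π := by
        cases N with
        | zero => intro a; exact a.elim0
        | succ N =>
          rw [Fin.strictMono_iff_lt_succ]
          intro i
          by_contra hcon
          have hne : π i.castSucc ≠ π i.succ := by
            intro hh
            have := congrArg Fin.val (π.injective hh)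
            simp at this
          have hlt : π i.succ < π i.castSucc := lt_of_le_of_ne (not_lt.mp hcon) hne.symm
          have hd : i.val + 1 ∈ descSet (N+1) π := by
            rw [mem_descSet]
            exact ⟨by omega, hlt⟩
          rw [h] at hd
          simp at hd
      have h2 : (fun i => π i) = id := by
        have e1 := Finset.orderEmbOfFin_unique (s := (Finset.univ : Finset (Fin N))) (by simp)
          (f := π) (by simp) hm
        have e2 := Finset.orderEmbOfFin_unique (s := (Finset.univ : Finset (Fin N))) (by simp)
          (f := id) (by simp) strictMono_id
        rw [e2]; exact e1
      ext1 i
      exact congrFun h2 i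
    · rintro rfl
      ext i
      cases i with
      | zero => simp [zero_notMem_descSet]
      | succ i =>
        rw [mem_descSet]
        simp
  refine ⟨⟨fun a b => Subtype.ext ?_⟩, ⟨⟨1, (key 1).mpr rfl⟩⟩⟩
  rw [(key _).mp a.2, (key _).mp b.2]

theorem dCount_FF (I : Finset ℕ) : ∃ L : List ℕ, L.Pairwise (· > ·) ∧ (∀ x, x ∈ L ↔ x ∈ I) ∧
    ∀ N : ℕ, (∀ i ∈ I, i < N) → (dCount I N : ℤ) = FF L N := by
  induction I using Finset.induction_on_max with
  | empty => exact ⟨[], by simp, by simp, by simp [dCount_empty, FF]⟩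
  | insert m J hJ ih =>
    obtain ⟨L, h1, h2, h3⟩ := ih
    refine ⟨m :: L, ?_, ?_, ?_⟩
    · rw [List.pairwise_cons]
      exact ⟨fun a ha => hJ a ((h2 a).mp ha), h1⟩
    · intro x; simp [h2]
    · intro N hN
      have hm := hN m (by simp)
      have hr := dCount_rec m N hm J hJ
      have hJN : ∀ i ∈ J, i < N := fun i hi => (hJ i hi).trans hm
      rw [FF, ← h3 N hJN, ← h3 m hJ, Ring.choose_natCast]
      zify at hr
      linarith

/-- Let `I` be a finite set of positive integers with `m = max(I ∪ {0})`
and let `p` be its descent polynomial (the unique polynomial of degree ≤ m agreeing with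
the permutation counts at all integers `n > m`).  Then `(−1)^m·d(I,−n) ≥ 0` for every
positive integer `n`, and `(−1)^m·d(I,−n) > 0` for every integer `n > 1`. -/
theorem stmt6 (I : Finset ℕ) (hpos : ∀ i ∈ I, 0 < i)
    (p : Polynomial ℚ) (hdeg : p.natDegree ≤ mI I)
    (hp : ∀ n : ℕ, mI I < n → p.eval (n : ℚ) = dCount I n) :
    (∀ n : ℕ, 0 < n → 0 ≤ (-1 : ℚ) ^ (mI I) * p.eval (-(n : ℚ))) ∧
    (∀ n : ℕ, 1 < n → 0 < (-1 : ℚ) ^ (mI I) * p.eval (-(n : ℚ))) := by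
  obtain ⟨L, hpw, hmem, hF⟩ := dCount_FF I
  obtain ⟨Q, hQ⟩ := FF_poly L
  have hle : ∀ i ∈ I, i ≤ mI I := fun i hi => Finset.le_sup (f := id) hi
  have hpQ : p = Q := by
    apply Polynomial.eq_of_infinite_eval_eq
    have hinf : (Set.Ioi (mI I)).Infinite := Set.Ioi_infinite _
    refine (hinf.image (f := fun n : ℕ => (n:ℚ)) (Nat.cast_injective.injOn)).mono ?_
    rintro _ ⟨n, hn, rfl⟩
    have hn : mI I < n := hn
    have e1 := hp n hn
    have e2 := hF n (fun i hi => lt_of_le_of_lt (hle i hi) hn)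
    have e3 := hQ n
    rw [← e2] at e3
    push_cast at e3
    show p.eval (n:ℚ) = Q.eval (n:ℚ)
    rw [e1, e3]
  have hev : ∀ n : ℕ, (-1 : ℚ) ^ (mI I) * p.eval (-(n : ℚ))
      = (((-1) ^ (mI I) * FF L (-n) : ℤ) : ℚ) := by
    intro n
    have := hQ (-n)
    push_cast at this ⊢
    rw [hpQ, this]
  have h0 : 0 ∉ L := fun h => lt_irrefl _ (hpos 0 ((hmem 0).mp h))
  simp only [hev, Int.cast_pos, Int.cast_nonneg_iff]
  cases L with
  | nil =>
    have hI : I = ∅ := by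
      ext x; rw [← hmem]; simp
    subst hI
    simp [FF, mI]
  | cons m L =>
    have hm : mI I = m := by
      apply le_antisymm
      · apply Finset.sup_le
        intro i hi
        have := (hmem i).mpr hi
        rw [List.pairwise_cons] at hpw
        rw [List.mem_cons] at this
        rcases this with rfl | h
        · exact le_rfl
        · exact (hpw.1 i h).le
      · exact hle m ((hmem m).mp (by simp))
    rw [hm]
    exact ⟨fun n hn => (FF_neg m L hpw n hn).1,
      fun n hn => (FF_neg m L hpw n (by omega)).2 h0 hn⟩
end

section
/- Let I be a nonempty finite set of positive integers with m = max(I). Then the sequence ā_0(I), ā_1(I), …, ā_{m−1}(I) is a monotone increasing (ā_0 ≤ ā_1 ≤ ⋯ ≤ ā_{m−1}), log-concave sequence of non-negative integers. -/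
/-- `IsABarCoeff I a` says that `a` is the coefficient sequence `ā_k(I)`, `0 ≤ k ≤ m−1`,
of the descent polynomial of `I` in the basis `{C(n−m+k, k+1)}`, i.e.
`d(I,n) = Σ_{k=0}^{m−1} ā_k(I)·C(n−m+k, k+1)` for all integers `n > m`
(the `k = −1` basis element has coefficient `ā_{−1}(I) = 0`).
These conditions determine `a 0, …, a (m−1)` uniquely. -/
def IsABarCoeff (I : Finset ℕ) (a : ℕ → ℚ) : Prop :=
  ∀ n : ℕ, mI I < n →
    (dCount I n : ℚ) =
      ∑ k ∈ Finset.range (mI I), a k * ((n - mI I + k).choose (k + 1))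

/-- Descent conditions of a permutation against a set `J`. -/
def PDes (J : Finset ℕ) (k : ℕ) (π : Equiv.Perm (Fin (k+1))) : Prop :=
  ∀ i (h : i + 1 < k + 1), (i + 1 ∈ J ↔ π ⟨i+1, h⟩ < π ⟨i, by omega⟩)

open Classical in
/-- Number of permutations of size `k+1` with descents given by `J` and last value `v`. -/
noncomputable def cnt (J : Finset ℕ) (k v : ℕ) : ℕ :=
  (Finset.univ.filter (fun π : Equiv.Perm (Fin (k+1)) =>
    PDes J k π ∧ (π (Fin.last k)).val = v)).card

/-- Append a last value to a permutation. -/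
def app {n : ℕ} (p : Fin (n+1) × Equiv.Perm (Fin n)) : Equiv.Perm (Fin (n+1)) :=
  (finSuccEquiv' (Fin.last n)).trans ((Equiv.optionCongr p.2).trans (finSuccEquiv' p.1).symm)

theorem app_last {n : ℕ} (p : Fin (n+1) × Equiv.Perm (Fin n)) : app p (Fin.last n) = p.1 := by
  simp [app]

theorem app_castSucc {n : ℕ} (p : Fin (n+1) × Equiv.Perm (Fin n)) (i : Fin n) :
    app p i.castSucc = p.1.succAbove (p.2 i) := by
  have h : finSuccEquiv' (Fin.last n) i.castSucc = some i := by
    rw [← Fin.succAbove_last_apply, finSuccEquiv'_succAbove]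
  simp [app, h]

theorem app_bij (n : ℕ) : Function.Bijective (app (n := n)) := by
  rw [Fintype.bijective_iff_injective_and_card]
  constructor
  · rintro ⟨v, σ⟩ ⟨w, τ⟩ h
    have h1 : v = w := by
      have := app_last (v, σ)
      rw [h, app_last] at this
      exact this.symm
    subst h1
    congr 1
    ext i
    have := app_castSucc (v, σ) i
    rw [h, app_castSucc] at this
    rw [Fin.succAbove_right_injective this]
  · simp [Fintype.card_perm, Nat.factorial_succ]

theorem PDes_app (J : Finset ℕ) (k : ℕ) (v : Fin (k+2)) (σ : Equiv.Perm (Fin (k+1))) :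
    PDes J (k+1) (app (v, σ)) ↔
      PDes J k σ ∧ (k + 1 ∈ J ↔ v.val ≤ (σ (Fin.last k)).val) := by
  have hc : ∀ i (h : i < k + 1), app (v, σ) ⟨i, by omega⟩ = v.succAbove (σ ⟨i, h⟩) := by
    intro i h
    exact app_castSucc (v, σ) ⟨i, h⟩
  have hl : app (v, σ) ⟨k+1, by omega⟩ = v := app_last (v, σ)
  constructor
  · intro H
    refine ⟨fun i h => ?_, ?_⟩
    · have := H i (by omega)
      rw [hc _ h, hc i (by omega), Fin.succAbove_lt_succAbove_iff] at this
      exact this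
    · have := H k (by omega)
      rw [hl, hc k (by omega), Fin.lt_succAbove_iff_le_castSucc] at this
      exact this
  · rintro ⟨H, h2⟩ i h
    rcases Nat.lt_or_ge i k with hi | hi
    · rw [hc (i+1) (by omega), hc i (by omega), Fin.succAbove_lt_succAbove_iff]
      exact H i (by omega)
    · obtain rfl : i = k := by omega
      rw [hl, hc i (by omega), Fin.lt_succAbove_iff_le_castSucc]
      exact h2

theorem cnt_zero_of_lt (J : Finset ℕ) (k v : ℕ) (h : k < v) : cnt J k v = 0 := by
  classical
  unfold cnt
  rw [Finset.card_eq_zero, Finset.filter_eq_empty_iff]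
  rintro π - ⟨-, h2⟩
  have := (π (Fin.last k)).isLt
  omega

theorem cnt_zero (J : Finset ℕ) : cnt J 0 0 = 1 := by
  classical
  unfold cnt
  rw [Finset.filter_true_of_mem]
  · simp
  · intro π _
    refine ⟨fun i h => by omega, by omega⟩

theorem cnt_succ (J : Finset ℕ) (k v : ℕ) (hv : v ≤ k + 1) :
    cnt J (k+1) v = ∑ u ∈ (Finset.range (k+1)).filter (fun u => k + 1 ∈ J ↔ v ≤ u), cnt J k u := by
  classical
  unfold cnt
  rw [← Finset.card_biUnion]
  · symm
    apply Finset.card_bij (fun σ _ => app (⟨v, by omega⟩, σ))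
    · intro σ hσ
      simp only [Finset.mem_biUnion, Finset.mem_filter, Finset.mem_univ, true_and] at hσ ⊢
      obtain ⟨u, ⟨_, h2⟩, h3, h4⟩ := hσ
      rw [PDes_app, app_last]
      refine ⟨⟨h3, ?_⟩, rfl⟩
      rw [h4]; exact h2
    · intro σ _ τ _ h
      have := (app_bij (k+1)).1 h
      simpa using this
    · intro π hπ
      simp only [Finset.mem_filter, Finset.mem_univ, true_and] at hπ
      obtain ⟨⟨w, σ⟩, rfl⟩ := (app_bij (k+1)).2 π
      rw [PDes_app, app_last] at hπ
      obtain ⟨⟨h1, h2⟩, h3⟩ := hπ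
      refine ⟨σ, ?_, ?_⟩
      · simp only [Finset.mem_biUnion, Finset.mem_filter, Finset.mem_univ, true_and]
        refine ⟨_, ⟨?_, ?_⟩, h1, rfl⟩
        · exact Finset.mem_range.2 (σ (Fin.last k)).isLt
        · rw [← h3]; exact h2
      · congr 2
        exact Fin.ext h3.symm
  · intro a _ b _ hab
    rw [Function.onFun, Finset.disjoint_left]
    intro σ h1 h2
    simp only [Finset.mem_filter] at h1 h2
    exact hab (h1.2.2.symm.trans h2.2.2)

theorem cnt_asc (J : Finset ℕ) (k v : ℕ) (hv : v ≤ k + 1) (hJ : k + 1 ∉ J) :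
    cnt J (k+1) v = ∑ u ∈ Finset.range v, cnt J k u := by
  rw [cnt_succ J k v hv]
  congr 1
  ext u
  simp [hJ]
  omega

theorem cnt_desc (J : Finset ℕ) (k v : ℕ) (hv : v ≤ k + 1) (hJ : k + 1 ∈ J) :
    cnt J (k+1) v = ∑ u ∈ Finset.Ico v (k+1), cnt J k u := by
  rw [cnt_succ J k v hv]
  congr 1
  ext u
  simp [hJ]
  omega

/-- Log-concavity without internal zeros. -/
def LC (f : ℕ → ℕ) : Prop := ∀ l x, f l * f (l+x+1) ≤ f (l+1) * f (l+x)

theorem LC.gen {f : ℕ → ℕ} (hf : LC f) : ∀ y l x, f l * f (l+x+y) ≤ f (l+x) * f (l+y) := by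
  intro y
  induction y with
  | zero => intro l x; simp [mul_comm]
  | succ y ih =>
    intro l x
    rcases x with _ | x
    · simp
    · calc f l * f (l+(x+1)+(y+1)) ≤ f (l+1) * f (l+(x+1)+y) := by
            have := hf l (x+1+y)
            convert this using 3 <;> ring
        _ ≤ f (l+(x+1)) * f (l+(y+1)) := by
            have := ih (l+1) x
            convert this using 3 <;> ring_nf

theorem LC_asc {f : ℕ → ℕ} (hf : LC f) : LC (fun v => ∑ u ∈ Finset.range v, f u) := by
  intro l x
  simp only [Finset.sum_range_succ]
  have key : (∑ u ∈ Finset.range l, f u) * f (l+x) ≤ f l * ∑ u ∈ Finset.range (l+x), f u := by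
    rw [Finset.sum_mul, add_comm l x, Finset.sum_range_add, mul_add, Finset.mul_sum, Finset.mul_sum]
    refine le_trans (Finset.sum_le_sum ?_) (Nat.le_add_left _ _)
    intro u hu
    obtain ⟨d, rfl⟩ := Nat.exists_eq_add_of_lt (Finset.mem_range.1 hu)
    have := hf.gen (d+1) u x
    calc _ = f u * f (u + x + (d+1)) := by congr 2; ring
      _ ≤ _ := this
      _ = _ := by rw [mul_comm]; congr 2; ring
  nlinarith

theorem LC_desc {f : ℕ → ℕ} (hf : LC f) (n : ℕ) : LC (fun v => ∑ u ∈ Finset.Ico v n, f u) := by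
  intro l x
  simp only
  rcases Nat.lt_or_ge (l+x) n with h | h
  · rw [Finset.sum_eq_sum_Ico_succ_bot h, Finset.sum_eq_sum_Ico_succ_bot (show l < n by omega)]
    have key : f l * ∑ u ∈ Finset.Ico (l+x+1) n, f u ≤ (∑ u ∈ Finset.Ico (l+1) n, f u) * f (l+x) := by
      calc _ = ∑ u ∈ Finset.Ico (l+1) (n-x), f l * f (u + x) := by
            rw [Finset.mul_sum, Finset.sum_Ico_add' (fun u => f l * f u)]
            congr 2 <;> omega
        _ ≤ ∑ u ∈ Finset.Ico (l+1) (n-x), f u * f (l+x) := by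
            apply Finset.sum_le_sum
            intro u hu
            obtain ⟨d, rfl⟩ := Nat.exists_eq_add_of_le (Finset.mem_Ico.1 hu).1
            have := hf.gen (d+1) l x
            calc _ = f l * f (l + x + (d+1)) := by congr 2; ring
              _ ≤ _ := this
              _ = _ := by rw [mul_comm]; congr 2; ring
        _ ≤ ∑ u ∈ Finset.Ico (l+1) n, f u * f (l+x) := by
            apply Finset.sum_le_sum_of_subset
            apply Finset.Ico_subset_Ico le_rfl (by omega)
        _ = _ := by rw [Finset.sum_mul]
    nlinarith
  · rw [Finset.Ico_eq_empty_of_le (show n ≤ l + x + 1 by omega)]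
    simp

theorem LC_cnt (J : Finset ℕ) (k : ℕ) : LC (cnt J k) := by
  induction k with
  | zero =>
    intro l x
    rw [cnt_zero_of_lt J 0 (l+x+1) (by omega)]
    simp
  | succ k ih =>
    intro l x
    rcases Nat.lt_or_ge (k+1) (l+x+1) with h | h
    · rw [cnt_zero_of_lt J (k+1) (l+x+1) (by omega)]
      simp
    · by_cases hJ : k + 1 ∈ J
      · rw [cnt_desc J k _ (by omega) hJ, cnt_desc J k _ (by omega) hJ,
          cnt_desc J k _ (by omega) hJ, cnt_desc J k _ (by omega) hJ]
        exact LC_desc ih _ l x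
      · rw [cnt_asc J k _ (by omega) hJ, cnt_asc J k _ (by omega) hJ,
          cnt_asc J k _ (by omega) hJ, cnt_asc J k _ (by omega) hJ]
        exact LC_asc ih l x

theorem pascal_sum (G : ℕ → ℕ) (r v : ℕ) :
    ∑ u ∈ Finset.range v, ∑ j ∈ Finset.range u, G j * (u-1-j).choose r =
      ∑ j ∈ Finset.range v, G j * (v-1-j).choose (r+1) := by
  induction v with
  | zero => simp
  | succ v ih =>
    rw [Finset.sum_range_succ, ih, Finset.sum_range_succ]
    simp only [Nat.add_sub_cancel, Nat.sub_self, Nat.choose_zero_succ, mul_zero, add_zero]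
    rw [← Finset.sum_add_distrib]
    apply Finset.sum_congr rfl
    intro j hj
    have := Finset.mem_range.1 hj
    obtain ⟨d, rfl⟩ := Nat.exists_eq_add_of_lt this
    rw [show j + d + 1 - j = d + 1 by omega, show j + d + 1 - 1 - j = d by omega,
      Nat.choose_succ_succ]
    ring

theorem cnt_sum (J : Finset ℕ) (m : ℕ) (hm : ∀ i ∈ J, i ≤ m) (r : ℕ) :
    ∀ v ≤ m + r + 1, ∑ u ∈ Finset.range v, cnt J (m+r) u =
      ∑ j ∈ Finset.range v, cnt J m j * (v-1-j).choose r := by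
  induction r with
  | zero => intro v _; simp
  | succ r ih =>
    intro v hv
    rw [← pascal_sum]
    apply Finset.sum_congr rfl
    intro u hu
    have := Finset.mem_range.1 hu
    rw [← ih u (by omega), ← add_assoc, cnt_asc J (m+r) u (by omega)]
    intro h
    have := hm _ h
    omega

theorem descSet_iff (I : Finset ℕ) (hpos : ∀ i ∈ I, 0 < i) (k : ℕ) (hk : ∀ i ∈ I, i ≤ k)
    (π : Equiv.Perm (Fin (k+1))) : descSet (k+1) π = I ↔ PDes I k π := by
  classical
  constructor
  · intro h i hi
    rw [← h]
    unfold descSet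
    rw [@Finset.mem_filter _ _ (Classical.decPred _), Finset.mem_Ioo]
    constructor
    · rintro ⟨_, h1, h2, h3⟩
      exact h3
    · intro h3
      exact ⟨⟨by omega, hi⟩, by omega, hi, h3⟩
  · intro h
    ext i
    unfold descSet
    rw [@Finset.mem_filter _ _ (Classical.decPred _), Finset.mem_Ioo]
    constructor
    · rintro ⟨⟨h0, _⟩, h1, h2, h3⟩
      obtain ⟨i, rfl⟩ : ∃ j, i = j + 1 := ⟨i - 1, by omega⟩
      exact (h i h2).2 h3
    · intro hi
      have h0 := hpos i hi
      have h1 := hk i hi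
      obtain ⟨i, rfl⟩ : ∃ j, i = j + 1 := ⟨i - 1, by omega⟩
      exact ⟨⟨by omega, by omega⟩, by omega, by omega, (h i (by omega)).1 hi⟩

theorem dCount_eq (I : Finset ℕ) (hpos : ∀ i ∈ I, 0 < i) (k : ℕ) (hk : ∀ i ∈ I, i ≤ k) :
    dCount I (k+1) = ∑ v ∈ Finset.range (k+1), cnt I k v := by
  classical
  unfold dCount
  simp only [descSet_iff I hpos k hk]
  rw [Nat.card_eq_fintype_card, Fintype.card_subtype]
  rw [Finset.card_eq_sum_card_fiberwise (f := fun π => (π (Fin.last k)).val)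
    (t := Finset.range (k+1))]
  · apply Finset.sum_congr rfl
    intro v _
    unfold cnt
    rw [Finset.filter_filter]
  · intro π _
    simp
    omega

theorem uniq (m : ℕ) : ∀ (d : ℕ) (b : ℕ → ℚ),
    (∀ r : ℕ, ∑ k ∈ Finset.range m, b k * ((r + d + k).choose k : ℚ) = 0) →
    ∀ k < m, b k = 0 := by
  induction m with
  | zero => intro _ _ _ k hk; omega
  | succ m ih =>
    intro d b h
    have h1 : ∀ k < m, b (k+1) = 0 := by
      apply ih (d+1) (fun k => b (k+1))
      intro r
      have e1 := h (r+1)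
      have e0 := h r
      rw [Finset.sum_range_succ'] at e0 e1
      have : ∑ k ∈ Finset.range m, b (k+1) * ((r + (d+1) + k).choose k : ℚ) =
        ∑ k ∈ Finset.range m, b (k+1) * ((r + 1 + d + (k+1)).choose (k+1) : ℚ) -
        ∑ k ∈ Finset.range m, b (k+1) * ((r + d + (k+1)).choose (k+1) : ℚ) := by
        rw [← Finset.sum_sub_distrib]
        apply Finset.sum_congr rfl
        intro k _
        rw [show r + 1 + d + (k+1) = (r + d + (k+1)) + 1 by ring, Nat.choose_succ_succ (r + d + (k+1)) k]
        rw [show r + (d+1) + k = r + d + (k+1) by ring]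
        push_cast
        ring
      rw [this]
      simp at e0 e1 ⊢
      linarith
    intro k hk
    rcases k with _ | k
    · have e0 := h 0
      rw [Finset.sum_range_succ', Finset.sum_eq_zero] at e0
      · simpa using e0
      · intro k hk
        rw [h1 k (Finset.mem_range.1 hk)]; simp
    · exact h1 k (by omega)

theorem coeff_eq (I : Finset ℕ) (hpos : ∀ i ∈ I, 0 < i)
    (a : ℕ → ℚ) (ha : IsABarCoeff I a) (hG : cnt I (mI I) (mI I) = 0) :
    ∀ k < mI I, a k = cnt I (mI I) (mI I - 1 - k) := by
  have hle : ∀ i ∈ I, i ≤ mI I := fun i hi => Finset.le_sup (f := id) hi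
  unfold IsABarCoeff at ha
  generalize mI I = m at *
  have key : ∀ r : ℕ, ∑ k ∈ Finset.range m,
      (a k - cnt I m (m - 1 - k)) * ((r + 1 + k).choose (k+1) : ℚ) = 0 := by
    intro r
    have h1 := ha (m + r + 1) (by omega)
    rw [dCount_eq I hpos (m+r) (fun i hi => (hle i hi).trans (by omega)),
      cnt_sum I m hle r _ le_rfl] at h1
    have h2 : ∑ j ∈ Finset.range (m+r+1), cnt I m j * (m+r+1-1-j).choose r =
        ∑ k ∈ Finset.range m, cnt I m (m-1-k) * (r+1+k).choose (k+1) := by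
      rw [add_assoc, Finset.sum_range_add, ← Finset.sum_range_reflect]
      rw [Finset.sum_eq_zero (s := Finset.range (r+1)), add_zero]
      · apply Finset.sum_congr rfl
        intro k hk
        have := Finset.mem_range.1 hk
        rw [show m + (r + 1) - 1 - (m - 1 - k) = r + 1 + k by omega]
        rw [Nat.choose_symm_of_eq_add (show r + 1 + k = r + (k+1) by ring)]
      · intro x _
        rcases x with _ | x
        · simp [hG]
        · rw [cnt_zero_of_lt _ _ _ (by omega)]; simp
    rw [h2] at h1
    simp only [sub_mul, Finset.sum_sub_distrib]
    push_cast at h1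
    rw [h1, sub_eq_zero]
    apply Finset.sum_congr rfl
    intro k _
    rw [show m + r + 1 - m + k = r + 1 + k by omega]
  have := uniq m 1 (fun k => a k - cnt I m (m - 1 - k)) (by
    intro r
    have e1 := key (r+1)
    have e0 := key r
    have e2 := congrArg₂ (· - ·) e1 e0
    simp only [sub_zero, ← Finset.sum_sub_distrib] at e2
    rw [← e2]
    apply Finset.sum_congr rfl
    intro k _
    rw [show r + 1 + 1 + k = (r + 1 + k) + 1 by ring, Nat.choose_succ_succ (r + 1 + k) k]
    push_cast
    ring)
  intro k hk
  exact sub_eq_zero.1 (this k hk)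

theorem stmt9 (I : Finset ℕ) (hI : I.Nonempty) (hpos : ∀ i ∈ I, 0 < i)
    (a : ℕ → ℚ) (ha : IsABarCoeff I a) :
    (∀ k : ℕ, k ≤ mI I - 1 → ∃ N : ℕ, a k = N) ∧
    (∀ k : ℕ, k + 1 ≤ mI I - 1 → a k ≤ a (k + 1)) ∧
    (∀ k : ℕ, 0 < k → k < mI I - 1 → a (k - 1) * a (k + 1) ≤ a k ^ 2) := by
  have hm : mI I ∈ I := by
    obtain ⟨i, hi, h⟩ := Finset.exists_mem_eq_sup I hI id
    unfold mI
    rw [h]; exact hi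
  have hm0 := hpos _ hm
  obtain ⟨M, hM⟩ : ∃ M, mI I = M + 1 := ⟨mI I - 1, by omega⟩
  have hd : ∀ v ≤ M + 1, cnt I (M+1) v = ∑ u ∈ Finset.Ico v (M+1), cnt I M u :=
    fun v hv => cnt_desc I M v hv (hM ▸ hm)
  have hG : cnt I (mI I) (mI I) = 0 := by
    rw [hM, hd _ le_rfl]; simp
  have hc := coeff_eq I hpos a ha hG
  rw [hM] at hc ⊢
  simp only [Nat.add_sub_cancel] at hc ⊢
  refine ⟨fun k hk => ⟨_, hc k (by omega)⟩, fun k hk => ?_, fun k h0 hk => ?_⟩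
  · rw [hc k (by omega), hc (k+1) (by omega), hd _ (by omega), hd _ (by omega)]
    exact_mod_cast Finset.sum_le_sum_of_subset (Finset.Ico_subset_Ico (by omega) le_rfl)
  · rw [hc (k-1) (by omega), hc (k+1) (by omega), hc k (by omega)]
    have := LC_cnt I (M+1) (M - (k+1)) 1
    rw [show M - (k+1) + 1 + 1 = M - (k-1) by omega, show M - (k+1) + 1 = M - k by omega] at this
    rw [mul_comm, sq]
    exact_mod_cast this
end

section
/- Let I be a nonempty finite set of positive integers with m = max(I), and define the polynomials a(I,x) = Σ_{k=0}^{m} a_k(I)·x^k and ā(I,x) = Σ_{k=0}^{m−1} ā_k(I)·x^k. Then a(I,x) = x·ā(I, x+1) as polynomials; equivalently, a_0(I) = 0 and a_l(I) = Σ_{k=l−1}^{m−1} ā_k(I)·C(k, l−1) for 1 ≤ l ≤ m. -/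
/-- `IsACoeff I a` says that `a` is the coefficient sequence `a_k(I)`, `0 ≤ k ≤ m`, of the
descent polynomial of `I` in the basis `{C(n−m, k)}_{k=0}^{m}`, i.e.
`d(I,n) = Σ_{k=0}^{m} a_k(I)·C(n−m, k)` for all integers `n > m`.
These conditions determine `a 0, …, a m` uniquely. -/
def IsACoeff (I : Finset ℕ) (a : ℕ → ℚ) : Prop :=
  ∀ n : ℕ, mI I < n →
    (dCount I n : ℚ) =
      ∑ k ∈ Finset.range (mI I + 1), a k * ((n - mI I).choose k)

theorem choose_comb_zero (m : ℕ) : ∀ c : ℕ → ℚ,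
    (∀ N : ℕ, 1 ≤ N → ∑ k ∈ Finset.range (m + 1), c k * (N.choose k : ℚ) = 0) →
    ∀ k ≤ m, c k = 0 := by
  induction m with
  | zero =>
    intro c h k hk
    have := h 1 le_rfl
    obtain rfl : k = 0 := by omega
    simpa using this
  | succ m ih =>
    intro c h
    have h1 : ∀ k ≤ m, c (k + 1) = 0 := by
      apply ih (fun k => c (k + 1))
      intro N hN
      have e1 := h N hN
      have e2 := h (N + 1) (by omega)
      rw [Finset.sum_range_succ'] at e1 e2
      simp only [Nat.choose_succ_succ', Nat.choose_zero_right, Nat.cast_add, mul_add,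
        Finset.sum_add_distrib] at e2
      simp only [Nat.choose_zero_right] at e1
      linarith
    intro k hk
    cases k with
    | succ k => exact h1 k (by omega)
    | zero =>
      have e := h 1 le_rfl
      rw [Finset.sum_range_succ', Finset.sum_eq_zero] at e
      · simpa using e
      · intro i hi
        rw [h1 i (by simp at hi; omega)]
        simp

theorem choose_vander (m N k : ℕ) (hk : k < m) :
    ((N + k).choose (k + 1) : ℚ) =
      ∑ l ∈ Finset.range m, (N.choose (l + 1) : ℚ) * (k.choose l : ℚ) := by
  rw [Nat.add_choose_eq, Finset.Nat.sum_antidiagonal_eq_sum_range_succ_mk,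
    Finset.sum_range_succ']
  simp only [Nat.sub_zero, Nat.choose_succ_self, mul_zero, add_zero]
  push_cast
  have hsub : Finset.range (k + 1) ⊆ Finset.range m := by
    intro x hx
    simp at hx ⊢
    omega
  rw [← Finset.sum_subset hsub]
  · apply Finset.sum_congr rfl
    intro l hl
    have : l ≤ k := by simp at hl; omega
    rw [Nat.choose_symm this]
  · intro l _ hl
    have : k < l := by simp at hl; omega
    rw [Nat.choose_eq_zero_of_lt this]
    simp

/-- For nonempty `I` with `m = max I`, the polynomials
`a(I,x) = Σ_{k=0}^{m} a_k(I)·x^k` and `ā(I,x) = Σ_{k=0}^{m−1} ā_k(I)·x^k` satisfy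
`a(I,x) = x·ā(I,x+1)`; equivalently, `a_0(I) = 0` and
`a_l(I) = Σ_{k=l−1}^{m−1} ā_k(I)·C(k, l−1)` for `1 ≤ l ≤ m`. -/
theorem stmt10 (I : Finset ℕ) (hI : I.Nonempty) (hpos : ∀ i ∈ I, 0 < i)
    (a abar : ℕ → ℚ) (ha : IsACoeff I a) (habar : IsABarCoeff I abar) :
    a 0 = 0 ∧
    (∀ l : ℕ, 1 ≤ l → l ≤ mI I →
      a l = ∑ k ∈ Finset.Icc (l - 1) (mI I - 1), abar k * (k.choose (l - 1))) := by
  have key := choose_comb_zero (mI I) (fun l => a l - if l = 0 then 0 else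
    ∑ k ∈ Finset.range (mI I), abar k * (k.choose (l - 1) : ℚ)) (by
      intro N hN
      have e1 := ha (mI I + N) (by omega)
      have e2 := habar (mI I + N) (by omega)
      rw [e1, Nat.add_sub_cancel_left] at e2
      simp only [sub_mul, Finset.sum_sub_distrib]
      rw [e2, sub_eq_zero, Finset.sum_range_succ']
      simp only [if_true, zero_mul, add_zero, Nat.add_sub_cancel, Nat.succ_ne_zero, if_false,
        Finset.sum_mul]
      rw [Finset.sum_comm]
      apply Finset.sum_congr rfl
      intro k hk
      rw [choose_vander (mI I) N k (by simpa using hk), Finset.mul_sum]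
      apply Finset.sum_congr rfl
      intro l _
      ring)
  refine ⟨by simpa using key 0 (by omega), ?_⟩
  intro l h1 h2
  have e := key l h2
  simp only [show l ≠ 0 by omega, if_false] at e
  rw [sub_eq_zero.mp e]
  symm
  apply Finset.sum_subset
  · intro x hx
    simp at hx ⊢
    omega
  · intro x hx hx2
    have : x < l - 1 := by
      simp at hx hx2
      by_contra hc
      have := hx2 (by omega)
      omega
    rw [Nat.choose_eq_zero_of_lt this]
    simp
end

section
/- Let I be a nonempty finite set of positive integers with m = max(I). Then the sequence a_0(I), a_1(I), …, a_m(I) is a log-concave sequence of non-negative integers; in particular, a_{k−1}(I)·a_{k+1}(I) ≤ a_k(I)² for all 0 < k < m. -/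
open Finset

namespace DescLC

/-- Log-concavity without internal zeros. -/
def LC (f : ℕ → ℕ) : Prop := ∀ i j, i ≤ j → f i * f (j + 1) ≤ f (i + 1) * f j

lemma LC.gen {f : ℕ → ℕ} (h : LC f) (s : ℕ) :
    ∀ a b, a ≤ b → f a * f (b + s) ≤ f (a + s) * f b := by
  induction s with
  | zero => intro a b _; simp
  | succ s ih =>
    intro a b hab
    rcases hab.eq_or_lt with rfl | hlt
    · rw [mul_comm]
    · have h1 := h a (b + s) (by omega)
      have h2 := ih (a + 1) b hlt
      have e : a + 1 + s = a + (s + 1) := by ring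
      rw [e] at h2
      exact h1.trans h2

lemma LC.head {f : ℕ → ℕ} (h : LC f) : LC (fun j => ∑ i ∈ range j, f i) := by
  intro i j hij
  simp only [sum_range_succ]
  have key : (∑ t ∈ range i, f t) * f j ≤ f i * ∑ t ∈ range j, f t := by
    obtain ⟨d, rfl⟩ := Nat.exists_eq_add_of_le hij
    have h1 : (∑ t ∈ range i, f t) * f (i + d) ≤ f i * ∑ t ∈ range i, f (d + t) := by
      rw [sum_mul, mul_sum]
      apply sum_le_sum
      intro t ht
      have ht' := mem_range.1 ht
      have := h.gen (i - t) t (d + t) (by omega)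
      rwa [show d + t + (i - t) = i + d by omega, show t + (i - t) = i by omega] at this
    refine h1.trans (Nat.mul_le_mul_left _ ?_)
    rw [add_comm i d, sum_range_add]
    exact Nat.le_add_left _ _
  nlinarith

lemma LC.tail {f : ℕ → ℕ} (h : LC f) (L : ℕ) : LC (fun j => ∑ i ∈ Ico j L, f i) := by
  intro i j hij
  rcases Nat.lt_or_ge j L with hj | hj
  swap
  · simp [Ico_eq_empty_of_le (show L ≤ j + 1 by omega)]
  simp only
  rw [sum_eq_sum_Ico_succ_bot (show i < L by omega), sum_eq_sum_Ico_succ_bot hj]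
  have key : f i * (∑ t ∈ Ico (j + 1) L, f t) ≤ (∑ t ∈ Ico (i + 1) L, f t) * f j := by
    obtain ⟨d, rfl⟩ := Nat.exists_eq_add_of_le hij
    have h1 : f i * (∑ t ∈ Ico (i + d + 1) L, f t) ≤
        (∑ t ∈ Ico (i + 1) (L - d), f t) * f (i + d) := by
      have e : ∑ t ∈ Ico (i + d + 1) L, f t = ∑ t ∈ Ico (i + 1) (L - d), f (t + d) := by
        rw [sum_Ico_add' f (i + 1) (L - d) d]
        congr 1
        congr 1 <;> omega
      rw [e, sum_mul, mul_sum]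
      apply sum_le_sum
      intro t ht
      have ht' := mem_Ico.1 ht
      have := h.gen d i t (by omega)
      linarith
    refine h1.trans (Nat.mul_le_mul_right _ ?_)
    exact sum_le_sum_of_subset (Ico_subset_Ico le_rfl (by omega))
  nlinarith

lemma LC.trunc {f : ℕ → ℕ} (h : LC f) (n : ℕ) : LC (fun j => if j ≤ n then f j else 0) := by
  intro i j hij
  by_cases hj : j + 1 ≤ n
  · simp only [hj, show i ≤ n by omega, show i + 1 ≤ n by omega, show j ≤ n by omega, if_true]
    exact h i j hij
  · simp [hj]

lemma LC.rev {f : ℕ → ℕ} (h : LC f) (m : ℕ) :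
    LC (fun t => if t < m then f (m - 1 - t) else 0) := by
  intro i j hij
  by_cases hj : j + 1 < m
  · simp only [hj, show i < m by omega, show i + 1 < m by omega, show j < m by omega, if_true]
    have := h (m - 1 - (j + 1)) (m - 1 - (i + 1)) (by omega)
    rw [show m - 1 - (j + 1) + 1 = m - 1 - j by omega,
      show m - 1 - (i + 1) + 1 = m - 1 - i by omega] at this
    linarith
  · simp [hj]

/-- iterated tail sums -/
def tau (m : ℕ) (G : ℕ → ℕ) : ℕ → ℕ → ℕ
  | 0 => G
  | k + 1 => fun s => ∑ t ∈ Ico s m, tau m G k t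

lemma tau_LC {m : ℕ} {G : ℕ → ℕ} (h : LC G) : ∀ k, LC (tau m G k)
  | 0 => h
  | k + 1 => (tau_LC h k).tail m

lemma tau_closed (m : ℕ) (G : ℕ → ℕ) (k : ℕ) :
    ∀ s, tau m G (k + 1) s = ∑ t ∈ Ico s m, (t - s + k).choose k * G t := by
  induction k with
  | zero => intro s; simp [tau]
  | succ k ih =>
    have aux : ∀ d s, m - s = d → tau m G (k + 1 + 1) s =
        ∑ t ∈ Ico s m, (t - s + (k + 1)).choose (k + 1) * G t := by
      intro d
      induction d with
      | zero =>
        intro s hs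
        simp [tau, Ico_eq_empty_of_le (show m ≤ s by omega)]
      | succ d ihd =>
        intro s hs
        have hsm : s < m := by omega
        have e1 : tau m G (k + 1 + 1) s = tau m G (k + 1) s + tau m G (k + 1 + 1) (s + 1) := by
          change ∑ t ∈ Ico s m, tau m G (k + 1) t = _ + ∑ t ∈ Ico (s + 1) m, tau m G (k + 1) t
          rw [sum_eq_sum_Ico_succ_bot hsm]
        rw [e1, ihd (s + 1) (by omega), ih s, sum_eq_sum_Ico_succ_bot hsm,
          sum_eq_sum_Ico_succ_bot hsm, add_assoc, ← sum_add_distrib]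
        congr 1
        · simp
        · apply sum_congr rfl
          intro t ht
          have ht' := mem_Ico.1 ht
          rw [show t - s + (k + 1) = (t - s + k) + 1 by omega, Nat.choose_succ_succ,
            show t - (s + 1) + (k + 1) = t - s + k by omega]
          ring
    intro s
    exact aux _ s rfl

lemma shift_LC {m : ℕ} {G : ℕ → ℕ} (h : LC G) (k : ℕ) :
    (∑ t ∈ range m, G t * t.choose k) * (∑ t ∈ range m, G t * t.choose (k + 2)) ≤
      (∑ t ∈ range m, G t * t.choose (k + 1)) ^ 2 := by
  have cl : ∀ k, ∑ t ∈ range m, G t * t.choose k = tau m G (k + 1) k := by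
    intro k
    rw [tau_closed]
    have : ∑ t ∈ Ico k m, (t - k + k).choose k * G t = ∑ t ∈ Ico k m, G t * t.choose k := by
      apply sum_congr rfl
      intro t ht
      have ht' := mem_Ico.1 ht
      rw [show t - k + k = t by omega, mul_comm]
    rw [this]
    symm
    apply sum_subset
    · intro t ht; simp at ht ⊢; omega
    · intro t ht h2
      simp at ht h2
      rw [Nat.choose_eq_zero_of_lt (by omega), mul_zero]
  have step : ∀ k s, tau m G (k + 1) s = (if s < m then tau m G k s else 0)
      + tau m G (k + 1) (s + 1) := by
    intro k s
    change ∑ t ∈ Ico s m, tau m G k t = _ + ∑ t ∈ Ico (s + 1) m, tau m G k t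
    split_ifs with hs
    · rw [sum_eq_sum_Ico_succ_bot hs]
    · simp [Ico_eq_empty_of_le (show m ≤ s by omega), Ico_eq_empty_of_le (show m ≤ s + 1 by omega)]
  have z : ∀ k s, m ≤ s → tau m G (k + 1) s = 0 := by
    intro k s hs
    change ∑ t ∈ Ico s m, tau m G k t = 0
    simp [Ico_eq_empty_of_le hs]
  have step' : ∀ k s, tau m G (k + 2) s = tau m G (k + 1) s + tau m G (k + 2) (s + 1) := by
    intro k s
    rw [step (k + 1) s]
    split_ifs with hs
    · rfl
    · rw [z k s (by omega)]
  rw [cl, cl, cl]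
  have hW := tau_LC (m := m) h (k + 3) k (k + 1) (by omega)
  have s1 := step' (k + 1) k
  have s2 := step' (k + 1) (k + 1)
  have s3 := step' k k
  simp only [show k + 2 + 1 = k + 3 by ring, show k + 1 + 2 = k + 3 by ring,
    show k + 1 + 1 = k + 2 by ring] at *
  generalize tau m G (k + 3) k = w0 at *
  generalize tau m G (k + 3) (k + 1) = w1 at *
  generalize tau m G (k + 3) (k + 2) = w2 at *
  generalize tau m G (k + 2) (k + 1) = u1 at *
  generalize tau m G (k + 2) k = u0 at *
  generalize tau m G (k + 1) k = t0 at *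
  subst s1 s2 s3
  nlinarith

/-- iterated head sums -/
def hd (F : ℕ → ℕ) : ℕ → ℕ → ℕ
  | 0 => F
  | r + 1 => fun j => ∑ i ∈ range j, hd F r i

lemma hd_closed (F : ℕ → ℕ) (r : ℕ) :
    ∀ j, hd F (r + 1) j = ∑ i ∈ range j, F i * (j - 1 - i).choose r := by
  induction r with
  | zero => intro j; simp [hd]
  | succ r ih =>
    intro j
    induction j with
    | zero => simp [hd]
    | succ j ihj =>
      have e : hd F (r + 1 + 1) (j + 1) = hd F (r + 1 + 1) j + hd F (r + 1) j := by
        change ∑ i ∈ range (j + 1), hd F (r + 1) i = ∑ i ∈ range j, hd F (r + 1) i + _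
        rw [sum_range_succ]
      rw [e, ihj, ih, sum_range_succ, ← sum_add_distrib]
      simp only [Nat.add_sub_cancel, Nat.sub_self, Nat.choose_zero_succ, mul_zero, add_zero]
      apply sum_congr rfl
      intro i hi
      have := mem_range.1 hi
      rw [show j - i = (j - 1 - i) + 1 by omega, Nat.choose_succ_succ]
      ring

lemma vand (t r : ℕ) (m : ℕ) (ht : t < m) (hr : 0 < r) :
    (t + r).choose (r - 1) = ∑ k ∈ range m, t.choose k * r.choose (k + 1) := by
  rw [Nat.add_choose_eq, Nat.sum_antidiagonal_eq_sum_range_succ_mk]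
  have hs : ∀ n, min m r ≤ n → ∑ k ∈ range n, t.choose k * r.choose (k + 1)
      = ∑ k ∈ range (min m r), t.choose k * r.choose (k + 1) := by
    intro n hn
    symm
    apply sum_subset
    · intro x; simp; omega
    · intro x _ hx
      simp at hx
      rcases Nat.lt_or_ge t x with h | h
      · rw [Nat.choose_eq_zero_of_lt h, zero_mul]
      · rw [Nat.choose_eq_zero_of_lt (show r < x + 1 by omega), mul_zero]
  rw [hs m (by omega), ← hs r (by omega), show (r - 1).succ = r by omega]
  apply sum_congr rfl
  intro k hk
  have := mem_range.1 hk
  simp only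
  rw [← Nat.choose_symm (show k + 1 ≤ r by omega), show r - 1 - k = r - (k + 1) by omega]

lemma uniq (M : ℕ) : ∀ c : ℕ → ℚ,
    (∀ r : ℕ, 1 ≤ r → ∑ k ∈ range (M + 1), c k * (r.choose k : ℚ) = 0) →
    ∀ k ≤ M, c k = 0 := by
  induction M with
  | zero =>
    intro c h k hk
    have := h 1 le_rfl
    simp at this
    rwa [Nat.le_zero.1 hk]
  | succ M ih =>
    intro c h
    have h1 : ∀ k ≤ M, c (k + 1) = 0 := by
      apply ih (fun k => c (k + 1))
      intro r hr
      have a1 := h (r + 1) (by omega)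
      have a2 := h r hr
      rw [sum_range_succ'] at a1 a2
      simp only [Nat.choose_succ_succ, Nat.choose_zero_right] at a1 a2
      have : ∑ k ∈ range (M + 1), c (k + 1) * ((r.choose k : ℚ)) =
        ∑ k ∈ range (M + 1), c (k + 1) * (((r.choose k + r.choose (k + 1) : ℕ) : ℚ))
        - ∑ k ∈ range (M + 1), c (k + 1) * ((r.choose (k + 1) : ℚ)) := by
        rw [← sum_sub_distrib]
        apply sum_congr rfl
        intro k _
        push_cast
        ring
      rw [this]
      simp only [Nat.succ_eq_add_one] at a1
      linarith
    intro k hk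
    rcases k with _ | k
    · have := h 1 le_rfl
      rw [sum_range_succ', sum_eq_zero] at this
      · simpa using this
      · intro x hx
        rw [h1 x (by have := mem_range.1 hx; omega), zero_mul]
    · exact h1 k (by omega)

/-- descents match `I` -/
def ok (I : Finset ℕ) (n : ℕ) (π : Equiv.Perm (Fin n)) : Prop :=
  ∀ i (h : i + 1 < n), (π ⟨i + 1, h⟩ < π ⟨i, by omega⟩ ↔ i + 1 ∈ I)

open Classical in
/-- number of permutations of size `n+1` with last value `j` -/
noncomputable def u (I : Finset ℕ) (n j : ℕ) : ℕ :=
  #{π : Equiv.Perm (Fin (n + 1)) | ok I (n + 1) π ∧ (π (Fin.last n)).val = j}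

/-- insert a last value -/
def ins {n : ℕ} (j : Fin (n + 1)) (σ : Equiv.Perm (Fin n)) : Equiv.Perm (Fin (n + 1)) :=
  ((finSuccEquiv' (Fin.last n)).trans (Equiv.optionCongr σ)).trans (finSuccEquiv' j).symm

lemma ins_last {n : ℕ} (j : Fin (n + 1)) (σ : Equiv.Perm (Fin n)) :
    ins j σ (Fin.last n) = j := by
  simp [ins]

lemma ins_castSucc {n : ℕ} (j : Fin (n + 1)) (σ : Equiv.Perm (Fin n)) (i : Fin n) :
    ins j σ i.castSucc = j.succAbove (σ i) := by
  simp only [ins, Equiv.trans_apply]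
  rw [finSuccEquiv'_last_apply_castSucc]
  simp

lemma ins_inj {n : ℕ} (j : Fin (n + 1)) : Function.Injective (ins j) := by
  intro σ τ h
  ext i
  have := congrArg (fun e => e i.castSucc) h
  simp only [ins_castSucc] at this
  rw [Fin.succAbove_right_injective this]

lemma ins_surj {n : ℕ} (j : Fin (n + 1)) (π : Equiv.Perm (Fin (n + 1)))
    (h : π (Fin.last n) = j) : ∃ σ, ins j σ = π := by
  have hne : ∀ i : Fin n, π i.castSucc ≠ j := by
    intro i hi
    rw [← h] at hi
    exact (Fin.castSucc_lt_last i).ne (π.injective hi)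
  choose f hf using fun i => Fin.exists_succAbove_eq (hne i)
  have finj : Function.Injective f := by
    intro a b hab
    have : π a.castSucc = π b.castSucc := by rw [← hf, ← hf, hab]
    exact Fin.castSucc_injective _ (π.injective this)
  refine ⟨Equiv.ofBijective f (Finite.injective_iff_bijective.1 finj), ?_⟩
  ext x
  refine Fin.lastCases ?_ (fun i => ?_) x
  · rw [ins_last, h]
  · rw [ins_castSucc, Equiv.ofBijective_apply, hf]

lemma ok_ins (I : Finset ℕ) {n : ℕ} (j : Fin (n + 2)) (σ : Equiv.Perm (Fin (n + 1))) :
    ok I (n + 2) (ins j σ) ↔ ok I (n + 1) σ ∧ (j.val ≤ (σ (Fin.last n)).val ↔ n + 1 ∈ I) := by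
  have c : ∀ i (h : i < n + 1), ins j σ ⟨i, by omega⟩ = j.succAbove (σ ⟨i, h⟩) := by
    intro i h; exact ins_castSucc j σ ⟨i, h⟩
  have l : ∀ h, ins j σ ⟨n + 1, h⟩ = j := fun h => ins_last j σ
  have key : j < j.succAbove (σ (Fin.last n)) ↔ j.val ≤ (σ (Fin.last n)).val := by
    rw [Fin.lt_succAbove_iff_le_castSucc]; rfl
  constructor
  · intro H
    constructor
    · intro i h
      have := H i (by omega)
      rw [c _ h, c i (by omega), Fin.succAbove_lt_succAbove_iff] at this
      exact this
    · have := H n (by omega)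
      rw [l, c n (by omega)] at this
      rw [← this, ← key]; rfl
  · rintro ⟨H1, H2⟩ i h
    rcases Nat.lt_or_ge i n with hi | hi
    · rw [c (i + 1) (by omega), c i (by omega), Fin.succAbove_lt_succAbove_iff]
      exact H1 i (by omega)
    · obtain rfl : i = n := by omega
      rw [l, c i (by omega), ← H2, ← key]; rfl

open Classical in
lemma u_sum (I : Finset ℕ) (n : ℕ) (P : ℕ → Prop) :
    #{π : Equiv.Perm (Fin (n + 1)) | ok I (n + 1) π ∧ P (π (Fin.last n)).val} =
      ∑ i ∈ range (n + 1) with P i, u I n i := by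
  rw [card_eq_sum_card_fiberwise (f := fun π => (π (Fin.last n)).val)
    (t := {i ∈ range (n + 1) | P i})]
  · apply sum_congr rfl
    intro i hi
    rw [u, filter_filter]
    congr 1
    ext π
    simp only [mem_filter, mem_univ, true_and] at hi ⊢
    constructor
    · rintro ⟨⟨a, b⟩, c⟩; exact ⟨a, c⟩
    · rintro ⟨a, c⟩; exact ⟨⟨a, c ▸ hi.2⟩, c⟩
  · intro π hπ
    simp at hπ ⊢
    exact ⟨Nat.lt_succ_iff.1 (π (Fin.last n)).isLt, hπ.2⟩

lemma u_succ (I : Finset ℕ) (n j : ℕ) (hj : j < n + 2) :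
    u I (n + 1) j = ∑ i ∈ range (n + 1) with (j ≤ i ↔ n + 1 ∈ I), u I n i := by
  classical
  have := u_sum I n (fun i => (j ≤ i ↔ n + 1 ∈ I))
  rw [u]
  convert this using 1
  · symm
    apply card_bij (fun σ _ => ins (⟨j, hj⟩ : Fin (n + 2)) σ)
    · intro σ hσ
      simp only [mem_filter, mem_univ, true_and] at hσ ⊢
      exact ⟨(ok_ins I _ _).2 hσ, by rw [ins_last]⟩
    · intro a _ b _ h
      exact ins_inj _ h
    · intro π hπ
      simp only [mem_filter, mem_univ, true_and] at hπ
      obtain ⟨σ, rfl⟩ := ins_surj ⟨j, hj⟩ π (Fin.ext hπ.2)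
      refine ⟨σ, ?_, rfl⟩
      simp only [mem_filter, mem_univ, true_and]
      exact (ok_ins I _ _).1 hπ.1
  · apply sum_congr _ (fun _ _ => rfl)
    ext; simp

lemma u_big (I : Finset ℕ) (n j : ℕ) (hj : n < j) : u I n j = 0 := by
  classical
  rw [u, card_eq_zero, filter_eq_empty_iff]
  rintro π _ ⟨_, h⟩
  have := (π (Fin.last n)).isLt
  omega

lemma u_desc (I : Finset ℕ) (n : ℕ) (h : n + 1 ∈ I) :
    u I (n + 1) = fun j => ∑ i ∈ Ico j (n + 1), u I n i := by
  ext j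
  rcases Nat.lt_or_ge j (n + 2) with hj | hj
  · rw [u_succ I n j hj]
    apply sum_congr _ (fun _ _ => rfl)
    ext; simp [h]; omega
  · rw [u_big _ _ _ (by omega), Ico_eq_empty_of_le (by omega), sum_empty]

lemma u_asc (I : Finset ℕ) (n : ℕ) (h : n + 1 ∉ I) (j : ℕ) (hj : j < n + 2) :
    u I (n + 1) j = ∑ i ∈ range j, u I n i := by
  rw [u_succ I n j hj]
  apply sum_congr _ (fun _ _ => rfl)
  ext; simp [h]; omega

lemma u_LC (I : Finset ℕ) (n : ℕ) : LC (u I n) := by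
  induction n with
  | zero =>
    intro i j hij
    rw [u_big I 0 (j + 1) (by omega)]; simp
  | succ n ih =>
    by_cases h : n + 1 ∈ I
    · rw [u_desc I n h]; exact ih.tail _
    · have : u I (n + 1) = fun j => if j ≤ n + 1 then ∑ i ∈ range j, u I n i else 0 := by
        ext j
        split_ifs with hj
        · exact u_asc I n h j (by omega)
        · exact u_big _ _ _ (by omega)
      rw [this]
      exact ih.head.trunc _

lemma u_hd (I : Finset ℕ) (m : ℕ) (hm : ∀ i ∈ I, i ≤ m) (r : ℕ) :
    ∀ j, j ≤ m + r → u I (m + r) j = hd (u I m) r j := by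
  induction r with
  | zero => intro j _; rfl
  | succ r ih =>
    intro j hj
    have hn : m + r + 1 ∉ I := fun h => by have := hm _ h; omega
    rw [← add_assoc, u_asc I (m + r) hn j (by omega)]
    apply sum_congr rfl
    intro i hi
    exact ih i (by have := mem_range.1 hi; omega)

lemma dCount_eq (I : Finset ℕ) (hpos : ∀ i ∈ I, 0 < i) (n : ℕ) (hn : ∀ i ∈ I, i ≤ n) :
    dCount I (n + 1) = ∑ i ∈ range (n + 1), u I n i := by
  classical
  have h := u_sum I n (fun _ => True)
  simp only [filter_true, and_true] at h
  rw [← h, dCount, Nat.card_eq_fintype_card, Fintype.card_subtype]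
  congr 1
  ext π
  simp only [mem_filter, mem_univ, true_and]
  constructor
  · intro e i hi
    rw [← e, descSet]
    simp only [mem_filter, mem_Ioo]
    constructor
    · intro hlt
      exact ⟨⟨by omega, hi⟩, by omega, hi, hlt⟩
    · rintro ⟨_, _, _, hlt⟩
      exact hlt
  · intro hok
    ext i
    rw [descSet]
    simp only [mem_filter, mem_Ioo]
    constructor
    · rintro ⟨⟨h0, h1⟩, _, _, hlt⟩
      obtain ⟨i, rfl⟩ := Nat.exists_eq_add_of_lt h0
      simp only [zero_add] at *
      exact (hok i h1).1 hlt
    · intro hi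
      have h0 := hpos i hi
      have h1 := hn i hi
      obtain ⟨i, rfl⟩ := Nat.exists_eq_add_of_lt h0
      simp only [zero_add] at *
      exact ⟨⟨h0, by omega⟩, by omega, by omega, (hok i (by omega)).2 hi⟩

/-- the coefficients -/
noncomputable def b (I : Finset ℕ) (m : ℕ) : ℕ → ℕ
  | 0 => 0
  | k + 1 => ∑ t ∈ range m, (if t < m then u I m (m - 1 - t) else 0) * t.choose k

lemma dCount_b (I : Finset ℕ) (hpos : ∀ i ∈ I, 0 < i) (m : ℕ) (hmI : m ∈ I)
    (hm : ∀ i ∈ I, i ≤ m) (r : ℕ) (hr : 0 < r) :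
    dCount I (m + r) = ∑ k ∈ range (m + 1), b I m k * r.choose k := by
  obtain ⟨r, rfl⟩ := Nat.exists_eq_add_of_lt hr
  simp only [zero_add] at *
  have hm0 := hpos m hmI
  rw [← add_assoc, dCount_eq I hpos (m + r) (fun i hi => by have := hm i hi; omega)]
  have e1 : ∑ i ∈ range (m + r + 1), u I (m + r) i = hd (u I m) (r + 1) (m + r + 1) := by
    apply sum_congr rfl
    intro i hi
    exact u_hd I m hm r i (by have := mem_range.1 hi; omega)
  have hz : ∀ i, m ≤ i → u I m i = 0 := by
    intro i hi
    obtain ⟨m, rfl⟩ := Nat.exists_eq_add_of_lt hm0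
    simp only [zero_add] at *
    rw [u_desc I m hmI]
    simp [Ico_eq_empty_of_le hi]
  have e2 : ∑ i ∈ range (m + r + 1), u I m i * (m + r + 1 - 1 - i).choose r
      = ∑ i ∈ range m, u I m i * (m + r - i).choose r := by
    symm
    apply sum_subset
    · intro x; simp; omega
    · intro x _ hx
      simp at hx
      rw [hz x hx, zero_mul]
  rw [e1, hd_closed, e2, sum_range_succ', b, zero_mul, add_zero, ← sum_range_reflect]
  simp only [b, sum_mul]
  rw [sum_comm]
  apply sum_congr rfl
  intro t ht
  have ht' := mem_range.1 ht
  rw [show m + r - (m - 1 - t) = t + (r + 1) by omega]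
  have := vand t (r + 1) m ht' (by omega)
  rw [Nat.add_sub_cancel] at this
  rw [this, mul_sum]
  apply sum_congr rfl
  intro k _
  rw [if_pos ht', mul_assoc]

end DescLC

open DescLC in
/-- For nonempty `I` with `m = max I`, the sequence
`a_0(I), a_1(I), …, a_m(I)` is a log-concave sequence of non-negative integers;
in particular `a_{k−1}(I)·a_{k+1}(I) ≤ a_k(I)²` for all `0 < k < m`. -/
theorem stmt11 (I : Finset ℕ) (hI : I.Nonempty) (hpos : ∀ i ∈ I, 0 < i)
    (a : ℕ → ℚ) (ha : IsACoeff I a) :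
    (∀ k : ℕ, k ≤ mI I → ∃ N : ℕ, a k = N) ∧
    (∀ k : ℕ, 0 < k → k < mI I → a (k - 1) * a (k + 1) ≤ a k ^ 2) := by
  have hmI : mI I ∈ I := by
    obtain ⟨i, hi, h⟩ := Finset.exists_mem_eq_sup I hI id
    rw [mI, h]; exact hi
  have hm : ∀ i ∈ I, i ≤ mI I := fun i hi => Finset.le_sup (f := id) hi
  have hab : ∀ k ≤ mI I, a k = (b I (mI I) k : ℚ) := by
    have := uniq (mI I) (fun k => a k - (b I (mI I) k : ℚ)) (by
      intro r hr
      have h1 := ha (mI I + r) (by omega)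
      rw [dCount_b I hpos _ hmI hm r hr, Nat.add_sub_cancel_left] at h1
      push_cast at h1
      simp only [sub_mul, sum_sub_distrib]
      linarith)
    intro k hk
    have := this k hk
    linarith
  refine ⟨fun k hk => ⟨_, hab k hk⟩, ?_⟩
  intro k hk hkm
  rw [hab _ (show k - 1 ≤ mI I by omega), hab _ (show k + 1 ≤ mI I by omega), hab k hkm.le]
  norm_cast
  obtain ⟨k, rfl⟩ := Nat.exists_eq_add_of_lt hk
  simp only [zero_add, Nat.add_sub_cancel]
  rcases k with _ | k
  · simp [b]
  · exact shift_LC ((u_LC I (mI I)).rev (mI I)) k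
end
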